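/- For every odd integer n ≥ 19, the minimum number of flips needed to sort the burnt stack Ī_n = [-1, -2, ..., -n] into I_n = [1, 2, ..., n] equals (3n+3)/2, i.e., T(n) = (3n+3)/2. -/

import Mathlib

/-- The flip of the top `k` pancakes of a burnt pancake stack `l`. -/
def pancakeFlip (k : ℕ) (l : List ℤ) : List ℤ :=
  ((l.take k).map Neg.neg).reverse ++ l.drop k

/-- Apply a sequence of flips (given by their sizes) successively to a stack. -/
def applyFlips (ks : List ℕ) (l : List ℤ) : List ℤ :=
  ks.foldl (fun s k => pancakeFlip k s) l

/-- The sorted stack `I_n = [1, 2, ..., n]`. -/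
def sortedStack (n : ℕ) : List ℤ := (List.range n).map (fun i => (i : ℤ) + 1)

/-- The reversed burnt stack `Ī_n = [-1, -2, ..., -n]`. -/
def burntStack (n : ℕ) : List ℤ := (List.range n).map (fun i => -((i : ℤ) + 1))

/-- A sequence of flips, each of size between `1` and `n`, transforming `Ī_n` into `I_n`. -/
def IsSortingSeq (n : ℕ) (ks : List ℕ) : Prop :=
  (∀ k ∈ ks, 1 ≤ k ∧ k ≤ n) ∧ applyFlips ks (burntStack n) = sortedStack n

/-- `T n` is the minimum number of flips transforming `Ī_n` into `I_n`. -/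
noncomputable def T (n : ℕ) : ℕ :=
  sInf {m | ∃ ks : List ℕ, IsSortingSeq n ks ∧ ks.length = m}

theorem sortedStack_eq_map (n : ℕ) :
    sortedStack n = (List.range n).map fun i : ℕ => (i : ℤ) + 1 := by
  change ((List.range n).flatMap fun i : ℕ => [(i : ℤ)]).map _ = _
  induction List.range n with
  | nil => rfl
  | cons x l ih => simp [ih]

theorem burntStack_eq_map (n : ℕ) :
    burntStack n = (List.range n).map fun i : ℕ => -((i : ℤ) + 1) := by
  change ((List.range n).flatMap fun i : ℕ => [(i : ℤ)]).map _ = _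
  induction List.range n with
  | nil => rfl
  | cons x l ih => simpa using ih

/-- The block `l` turned upside down as a whole. -/
def negRev (l : List ℤ) : List ℤ := (l.map Neg.neg).reverse

@[simp] theorem negRev_nil : negRev [] = [] := rfl

@[simp] theorem negRev_append (a b : List ℤ) : negRev (a ++ b) = negRev b ++ negRev a := by
  simp [negRev]

@[simp] theorem negRev_cons (x : ℤ) (b : List ℤ) : negRev (x :: b) = negRev b ++ [-x] := by
  simp [negRev]

@[simp] theorem negRev_negRev (a : List ℤ) : negRev (negRev a) = a := by
  simp [negRev]

@[simp] theorem length_negRev (a : List ℤ) : (negRev a).length = a.length := by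
  simp [negRev]

@[simp] theorem applyFlips_nil (l : List ℤ) : applyFlips [] l = l := rfl

@[simp] theorem applyFlips_cons (k : ℕ) (ks : List ℕ) (l : List ℤ) :
    applyFlips (k :: ks) l = applyFlips ks (pancakeFlip k l) := rfl

theorem applyFlips_append (ks ks' : List ℕ) (l : List ℤ) :
    applyFlips (ks ++ ks') l = applyFlips ks' (applyFlips ks l) := by
  simp [applyFlips]

theorem pancakeFlip_append (a b : List ℤ) : pancakeFlip a.length (a ++ b) = negRev a ++ b := by
  simp [pancakeFlip, negRev]

@[simp] theorem length_pancakeFlip (k : ℕ) (l : List ℤ) : (pancakeFlip k l).length = l.length := by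
  simp [pancakeFlip]; omega

@[simp] theorem length_applyFlips (ks : List ℕ) (l : List ℤ) :
    (applyFlips ks l).length = l.length := by
  induction ks generalizing l with
  | nil => rfl
  | cons k ks ih => simp [ih]

/-- The stack `l` can be transformed into `l'` by a sequence of `d` flips. -/
def Reach (d : ℕ) (l l' : List ℤ) : Prop :=
  ∃ ks : List ℕ, ks.length = d ∧ (∀ k ∈ ks, 1 ≤ k ∧ k ≤ l.length) ∧ applyFlips ks l = l'

theorem Reach.trans {d e : ℕ} {a b c : List ℤ} (h : Reach d a b) (h' : Reach e b c) :
    Reach (d + e) a c := by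
  obtain ⟨ks, rfl, hk, rfl⟩ := h
  obtain ⟨ks', rfl, hk', rfl⟩ := h'
  refine ⟨ks ++ ks', by simp, ?_, applyFlips_append _ _ _⟩
  intro k hk2
  rcases List.mem_append.1 hk2 with h | h
  · exact hk k h
  · simpa using hk' k h

theorem Reach.flip {a b : List ℤ} (ha : a ≠ []) : Reach 1 (a ++ b) (negRev a ++ b) := by
  refine ⟨[a.length], rfl, ?_, pancakeFlip_append a b⟩
  have := List.length_pos_iff.2 ha
  simp; omega

theorem Reach.length_eq {d : ℕ} {a b : List ℤ} (h : Reach d a b) : a.length = b.length := by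
  obtain ⟨ks, -, -, rfl⟩ := h
  simp

/-- In any context, turning over the part of the stack on top of the block `x` while replacing `x`
by `y` can be done with `d` flips. -/
def Swap (d : ℕ) (x y : List ℤ) : Prop :=
  ∀ a b : List ℤ, a ≠ [] → Reach d (a ++ x ++ b) (negRev a ++ y ++ b)

theorem Swap.length_eq {d : ℕ} {x y : List ℤ} (h : Swap d x y) : x.length = y.length := by
  simpa using (h [0] [] (by simp)).length_eq

theorem exists_swap_swap_swap (j : ℕ) : ∀ x : List ℤ, x.length = 4 * j + 1 → ∃ y z : List ℤ,
    Swap (2 * j + 1) x y ∧ Swap (2 * j + 1) (negRev y) z ∧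
      Swap (2 * j + 1) (negRev z) x.reverse := by
  induction j with
  | zero =>
    intro x hx
    have key : ∀ u, Swap (2 * 0 + 1) u u := fun u a b ha => by
      simpa using Reach.flip (b := u ++ b) ha
    obtain ⟨t, rfl⟩ := List.length_eq_one_iff.1 hx
    exact ⟨[t], [-t], key _, key _, by simpa using key [t]⟩
  | succ j ih =>
    intro x hx
    match x, hx with
    | x₁ :: x₂ :: x₃ :: x₄ :: x, hx =>
    obtain ⟨y, z, h₁, h₂, h₃⟩ := ih x (by simp at hx; omega)
    refine ⟨[x₃, x₄, x₁, x₂] ++ y, [-x₁, -x₄] ++ z ++ [-x₂, -x₃], ?_, ?_, ?_⟩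
    · intro a b ha
      have s₁ := Reach.flip (a := a ++ [x₁, x₂]) (b := [x₃, x₄] ++ x ++ b) (by simp)
      have s₂ := h₁ ([-x₂, -x₁] ++ negRev a ++ [x₃, x₄]) b (by simp)
      have s₃ := Reach.flip (a := [-x₄, -x₃] ++ a) (b := [x₁, x₂] ++ y ++ b) (by simp)
      simp only [negRev_append, negRev_negRev, negRev_cons, negRev_nil, List.append_assoc,
        List.cons_append, List.nil_append, neg_neg] at s₁ s₂ s₃ ⊢
      convert (s₁.trans s₂).trans s₃ using 1
      ring
    · intro a b ha
      have s₁ := Reach.flip (a := a ++ negRev y ++ [-x₂]) (b := [-x₁, -x₄, -x₃] ++ b) (by simp)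
      have s₂ := Reach.flip (a := [x₂] ++ y ++ negRev a ++ [-x₁, -x₄]) (b := [-x₃] ++ b) (by simp)
      have s₃ := h₂ ([x₄, x₁] ++ a) ([-x₂, -x₃] ++ b) (by simp)
      simp only [negRev_append, negRev_negRev, negRev_cons, negRev_nil, List.append_assoc,
        List.cons_append, List.nil_append, neg_neg] at s₁ s₂ s₃ ⊢
      convert (s₁.trans s₂).trans s₃ using 1
      ring
    · intro a b ha
      have s₁ := h₃ (a ++ [x₃, x₂]) ([x₄, x₁] ++ b) (by simp)
      have s₂ := Reach.flip (a := [-x₂, -x₃] ++ negRev a ++ x.reverse ++ [x₄]) (b := [x₁] ++ b)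
        (by simp)
      have s₃ := Reach.flip (a := [-x₄] ++ negRev x.reverse ++ a) (b := [x₃, x₂, x₁] ++ b)
        (by simp)
      simp only [negRev_append, negRev_negRev, negRev_cons, negRev_nil, List.append_assoc,
        List.cons_append, List.nil_append, neg_neg, List.reverse_cons] at s₁ s₂ s₃ ⊢
      convert (s₁.trans s₂).trans s₃ using 1
      ring

/-- Replace the pancake `-p` by the block `c` and shift the labels larger than `p` accordingly. -/
def inflate (p : ℤ) (c : List ℤ) (t : ℤ) : List ℤ :=
  if t = -p then c else if t = p then negRev c
  else if |t| < p then [t] else if 0 < t then [t + (c.length - 1)] else [t - (c.length - 1)]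

theorem inflate_neg {p : ℤ} (hp : 0 < p) (c : List ℤ) (t : ℤ) :
    inflate p c (-t) = negRev (inflate p c t) := by
  unfold inflate
  rw [abs_neg]
  rcases abs_cases t with h | h <;> split_ifs <;> first | omega | (simp; try omega)

theorem flatMap_inflate_negRev {p : ℤ} (hp : 0 < p) (c l : List ℤ) :
    (negRev l).flatMap (inflate p c) = negRev (l.flatMap (inflate p c)) := by
  induction l with
  | nil => rfl
  | cons x l ih => simp [ih, inflate_neg hp]

theorem flatMap_inflate_congr {p : ℤ} {c d l : List ℤ} (hcd : c.length = d.length)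
    (h : p ∉ l) (h' : -p ∉ l) : l.flatMap (inflate p c) = l.flatMap (inflate p d) := by
  apply List.flatMap_congr
  intro t ht
  have h₁ : t ≠ p := fun h₁ => h (h₁ ▸ ht)
  have h₂ : t ≠ -p := fun h₁ => h' (h₁ ▸ ht)
  simp [inflate, h₁, h₂, hcd]

theorem inflate_ne_nil {p : ℤ} {c : List ℤ} (hc : c ≠ []) (t : ℤ) : inflate p c t ≠ [] := by
  have : negRev c ≠ [] := by
    rw [← List.length_pos_iff] at hc ⊢
    simpa using hc
  unfold inflate
  split_ifs <;> simp_all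

theorem flatMap_inflate_ne_nil {p : ℤ} {c l : List ℤ} (hc : c ≠ []) (hl : l ≠ []) :
    l.flatMap (inflate p c) ≠ [] := by
  cases l with
  | nil => exact absurd rfl hl
  | cons x l => simp [inflate_ne_nil hc]

theorem reach_flatMap_inflate {p : ℤ} (hp : 0 < p) {c : List ℤ} (hc : c ≠ []) {ks : List ℕ}
    (hks : ∀ k ∈ ks, 1 ≤ k) : ∀ l : List ℤ, l ≠ [] →
    Reach ks.length (l.flatMap (inflate p c)) ((applyFlips ks l).flatMap (inflate p c)) := by
  induction ks with
  | nil => exact fun l _ => ⟨[], rfl, by simp, rfl⟩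
  | cons k ks ih =>
    intro l hl
    have hk : 1 ≤ k := hks k (by simp)
    have hl' : pancakeFlip k l ≠ [] := by
      rw [← List.length_pos_iff] at hl ⊢
      simpa using hl
    have s₁ : Reach 1 (l.flatMap (inflate p c)) ((pancakeFlip k l).flatMap (inflate p c)) := by
      have h₁ : l.take k ≠ [] := by
        simp [hl]; omega
      have := Reach.flip (b := (l.drop k).flatMap (inflate p c))
        (flatMap_inflate_ne_nil (p := p) hc h₁)
      rw [← flatMap_inflate_negRev hp, ← List.flatMap_append, ← List.flatMap_append,
        List.take_append_drop] at this
      exact this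
    have := s₁.trans (ih (fun k hk => hks k (by simp [hk])) _ hl')
    rw [List.length_cons, add_comm]
    exact this

theorem reach_swap_inflate {p : ℤ} (hp : 0 < p) {c d a b : List ℤ} {t : ℤ} {m : ℕ}
    (hcd : c.length = d.length) (ha : a ≠ []) (hc : c ≠ [])
    (ha₁ : p ∉ a) (ha₂ : -p ∉ a) (hb₁ : p ∉ b) (hb₂ : -p ∉ b)
    (h : Swap m (inflate p c t) (inflate p d t)) :
    Reach m ((a ++ t :: b).flatMap (inflate p c)) ((negRev a ++ t :: b).flatMap (inflate p d)) := by
  have := h _ (b.flatMap (inflate p c)) (flatMap_inflate_ne_nil (p := p) hc ha)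
  simpa [flatMap_inflate_negRev hp, flatMap_inflate_congr hcd ha₁ ha₂,
    flatMap_inflate_congr hcd hb₁ hb₂] using this

theorem flatMap_map_of_eq_singleton {f : ℤ → List ℤ} {g h : ℕ → ℤ} {l : List ℕ}
    (hl : ∀ i ∈ l, f (g i) = [h i]) : (l.map g).flatMap f = l.map h := by
  induction l with
  | nil => rfl
  | cons x l ih => simp_all

theorem flatMap_inflate_range (P r m : ℕ) {s : ℤ} (hs : s = 1 ∨ s = -1) {c : List ℤ}
    (hc : c.length = m + 1) :
    ((List.range (P + 1 + r)).map fun i : ℕ => s * ((i : ℤ) + 1)).flatMap (inflate (P + 1) c) =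
      ((List.range P).map fun i : ℕ => s * ((i : ℤ) + 1)) ++ inflate (P + 1) c (s * (P + 1)) ++
        (List.range r).map fun i : ℕ => s * ((P + 1 + m + i : ℤ) + 1) := by
  rw [List.range_add, List.range_succ (n := P)]
  simp only [List.map_append, List.flatMap_append, List.map_map]
  congr 1
  · congr 1
    · apply flatMap_map_of_eq_singleton
      intro i hi
      have := List.mem_range.1 hi
      unfold inflate
      rcases hs with rfl | rfl
      · rw [if_neg (by omega), if_neg (by omega), if_pos (by rw [abs_lt]; omega)]
      · rw [if_neg (by omega), if_neg (by omega), if_pos (by rw [abs_lt]; omega)]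
    · simp
  · apply flatMap_map_of_eq_singleton
    intro i hi
    simp only [Function.comp_apply]
    unfold inflate
    rcases hs with rfl | rfl
    · rw [if_neg (by push_cast; omega), if_neg (by push_cast; omega),
        if_neg (by rw [abs_lt]; push_cast; omega), if_pos (by push_cast; omega)]
      simp [hc]
      ring
    · rw [if_neg (by push_cast; omega), if_neg (by push_cast; omega),
        if_neg (by rw [abs_lt]; push_cast; omega), if_neg (by push_cast; omega)]
      simp [hc]
      ring

theorem flatMap_inflate_burntStack (P r m : ℕ) :
    (burntStack (P + 1 + r)).flatMap
      (inflate (P + 1) ((List.range (m + 1)).map fun i : ℕ => -((P : ℤ) + i + 1))) =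
      burntStack (P + 1 + r + m) := by
  have := flatMap_inflate_range P r m (s := -1) (by simp)
    (c := (List.range (m + 1)).map fun i : ℕ => -((P : ℤ) + i + 1)) (by simp)
  simp only [burntStack_eq_map, neg_one_mul] at this ⊢
  rw [this, show P + 1 + r + m = P + (m + 1) + r by ring, List.range_add (n := P + (m + 1)),
    List.range_add (n := P) (m := m + 1)]
  simp [inflate, Function.comp_def]
  intros
  ring

theorem flatMap_inflate_sortedStack (P r m : ℕ) :
    (sortedStack (P + 1 + r)).flatMap
      (inflate (P + 1) ((List.range (m + 1)).map fun i : ℕ => -((P : ℤ) + i + 1)).reverse) =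
      sortedStack (P + 1 + r + m) := by
  have := flatMap_inflate_range P r m (s := 1) (by simp)
    (c := ((List.range (m + 1)).map fun i : ℕ => -((P : ℤ) + i + 1)).reverse) (by simp)
  simp only [sortedStack_eq_map, one_mul] at this ⊢
  rw [this, show P + 1 + r + m = P + (m + 1) + r by ring, List.range_add (n := P + (m + 1)),
    List.range_add (n := P) (m := m + 1)]
  have h₂ : ¬ ((P : ℤ) + 1 = -1 + -P) := by omega
  simp [inflate, negRev, Function.comp_def, h₂]
  intros
  ring

theorem reach_burntStack_sortedStack_add {P r : ℕ} {w₀ w₁ w₂ w₃ : List ℕ}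
    {a₁ b₁ a₂ b₂ a₃ b₃ : List ℤ}
    (hw : ∀ k ∈ w₀ ++ w₁ ++ w₂ ++ w₃, 1 ≤ k)
    (h₀ : applyFlips w₀ (burntStack (P + 1 + r)) = a₁ ++ -((P : ℤ) + 1) :: b₁)
    (h₁ : applyFlips w₁ (negRev a₁ ++ -((P : ℤ) + 1) :: b₁) = a₂ ++ ((P : ℤ) + 1) :: b₂)
    (h₂ : applyFlips w₂ (negRev a₂ ++ ((P : ℤ) + 1) :: b₂) = a₃ ++ -((P : ℤ) + 1) :: b₃)
    (h₃ : applyFlips w₃ (negRev a₃ ++ -((P : ℤ) + 1) :: b₃) = sortedStack (P + 1 + r))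
    (ha₁ : a₁ ≠ []) (ha₂ : a₂ ≠ []) (ha₃ : a₃ ≠ [])
    (hn : ((P : ℤ) + 1) ∉ a₁ ++ b₁ ++ a₂ ++ b₂ ++ a₃ ++ b₃)
    (hn' : -((P : ℤ) + 1) ∉ a₁ ++ b₁ ++ a₂ ++ b₂ ++ a₃ ++ b₃) (j : ℕ) :
    Reach (w₀.length + w₁.length + w₂.length + w₃.length + 3 + 6 * j)
      (burntStack (P + 1 + r + 4 * j)) (sortedStack (P + 1 + r + 4 * j)) := by
  have hp : (0 : ℤ) < P + 1 := by omega
  have hp' : (P : ℤ) + 1 ≠ -(P + 1) := by omega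
  obtain ⟨y, z, t₁, t₂, t₃⟩ := exists_swap_swap_swap j
    ((List.range (4 * j + 1)).map fun i : ℕ => -((P : ℤ) + i + 1)) (by simp)
  have hl := flatMap_inflate_burntStack P r (4 * j)
  have hl' := flatMap_inflate_sortedStack P r (4 * j)
  generalize hx : ((List.range (4 * j + 1)).map fun i : ℕ => -((P : ℤ) + i + 1)) = x at *
  have hxl : x.length = 4 * j + 1 := by simp [← hx]
  have hyl : y.length = 4 * j + 1 := by rw [← t₁.length_eq, hxl]
  have hzl : z.length = 4 * j + 1 := by rw [← t₂.length_eq, length_negRev, hyl]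
  have hne : ∀ {u : List ℤ}, u.length = 4 * j + 1 → u ≠ [] := by
    rintro u hu rfl
    simp at hu
  have e₀ := reach_flatMap_inflate hp (hne hxl) (ks := w₀) (by simp_all)
    (burntStack (P + 1 + r)) (by simp [burntStack_eq_map])
  have e₁ := reach_flatMap_inflate hp (hne hyl) (ks := w₁) (by simp_all)
    (negRev a₁ ++ -((P : ℤ) + 1) :: b₁) (by simp)
  have e₂ := reach_flatMap_inflate hp (c := negRev z) (hne (by simpa using hzl)) (ks := w₂)
    (by simp_all) (negRev a₂ ++ ((P : ℤ) + 1) :: b₂) (by simp)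
  have e₃ := reach_flatMap_inflate hp (c := x.reverse) (hne (by simpa using hxl)) (ks := w₃)
    (by simp_all) (negRev a₃ ++ -((P : ℤ) + 1) :: b₃) (by simp)
  rw [h₀, hl] at e₀
  rw [h₁] at e₁
  rw [h₂] at e₂
  rw [h₃, hl'] at e₃
  have i₁ : ∀ c, inflate ((P : ℤ) + 1) c (-(P + 1)) = c := fun c => by simp [inflate]
  have i₂ : ∀ c, inflate ((P : ℤ) + 1) c (P + 1) = negRev c := fun c => by
    rw [inflate, if_neg hp', if_pos rfl]
  have g₁ := reach_swap_inflate hp (a := a₁) (b := b₁) (c := x) (d := y)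
    (t := -((P : ℤ) + 1)) (m := 2 * j + 1) (by omega) ha₁ (hne hxl)
    (fun h => hn (by simp [h])) (fun h => hn' (by simp only [List.mem_append]; tauto))
    (fun h => hn (by simp [h])) (fun h => hn' (by simp only [List.mem_append]; tauto))
    (by rwa [i₁, i₁])
  have g₂ := reach_swap_inflate hp (a := a₂) (b := b₂) (c := y) (d := negRev z)
    (t := ((P : ℤ) + 1)) (m := 2 * j + 1) (by simp; omega) ha₂ (hne hyl)
    (fun h => hn (by simp [h])) (fun h => hn' (by simp only [List.mem_append]; tauto))
    (fun h => hn (by simp [h])) (fun h => hn' (by simp only [List.mem_append]; tauto))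
    (by rwa [i₂, i₂, negRev_negRev])
  have g₃ := reach_swap_inflate hp (a := a₃) (b := b₃) (c := negRev z) (d := x.reverse)
    (t := -((P : ℤ) + 1)) (m := 2 * j + 1) (by simp; omega) ha₃ (hne (by simpa using hzl))
    (fun h => hn (by simp [h])) (fun h => hn' (by simp only [List.mem_append]; tauto))
    (fun h => hn (by simp [h])) (fun h => hn' (by simp only [List.mem_append]; tauto))
    (by rwa [i₁, i₁])
  convert (((((e₀.trans g₁).trans e₁).trans g₂).trans e₂).trans g₃).trans e₃ using 1
  ring

theorem reach_of_decide {n : ℕ} {w : List ℕ} (h : ∀ k ∈ w, 1 ≤ k ∧ k ≤ n)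
    (h' : applyFlips w (burntStack n) = sortedStack n) :
    Reach w.length (burntStack n) (sortedStack n) :=
  ⟨w, rfl, by simpa [burntStack_eq_map] using h, h'⟩

set_option maxRecDepth 10000 in
theorem reach_nineteen : Reach 30 (burntStack 19) (sortedStack 19) :=
  reach_of_decide (w := [19, 14, 7, 4, 10, 18, 6, 4, 10, 19, 14, 4, 9, 11, 8, 18, 8, 11, 9, 4, 14,
    19, 10, 4, 6, 18, 10, 4, 7, 14]) (by decide) (by decide)

set_option maxRecDepth 10000 in
theorem reach_twentyThree : Reach 36 (burntStack 23) (sortedStack 23) :=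
  reach_of_decide (w := [23, 18, 11, 7, 4, 14, 22, 6, 4, 10, 23, 18, 4, 13, 15, 11, 13, 10, 22, 10,
    13, 11, 15, 13, 4, 18, 23, 10, 4, 6, 22, 14, 4, 7, 11, 18]) (by decide) (by decide)

set_option maxRecDepth 10000 in
theorem reach_twentyOne_add (j : ℕ) :
    Reach (33 + 6 * j) (burntStack (21 + 4 * j)) (sortedStack (21 + 4 * j)) :=
  reach_burntStack_sortedStack_add (P := 11) (r := 9)
    (w₀ := [21, 15, 8, 12, 7, 20, 15])
    (w₁ := [18, 7, 9, 21, 15, 6, 17, 8, 15, 20, 18])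
    (w₂ := [14, 19, 7, 11, 7, 14, 16, 6, 12])
    (w₃ := [17, 10, 8])
    (a₁ := [-17, -18, -10, -11])
    (b₁ := [-13, -14, -19, -20, -21, 6, 5, 4, 3, 2, 16, 15, -7, -8, -9, 1])
    (a₂ := [4, 3, 13])
    (b₂ := [-17, -16, -2, -1, 9, 8, 11, 10, 18, 19, 14, 15, -7, -6, -5, 20, 21])
    (a₃ := [13, 14, 15, 16, 17])
    (b₃ := [-11, -8, -7, -6, -5, -4, -3, -2, -1, 9, 10, 18, 19, 20, 21])
    (by decide) (by decide) (by decide) (by decide) (by decide) (by simp) (by simp) (by simp)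
    (by decide) (by decide) j

set_option maxRecDepth 10000 in
theorem reach_twentySeven_add (j : ℕ) :
    Reach (42 + 6 * j) (burntStack (27 + 4 * j)) (sortedStack (27 + 4 * j)) :=
  reach_burntStack_sortedStack_add (P := 11) (r := 15)
    (w₀ := [27, 10, 6, 24, 6, 12, 8, 16, 6, 20])
    (w₁ := [26, 4, 16, 27, 14, 10, 24, 6, 12])
    (w₂ := [26, 18, 12, 6, 24, 10, 14, 27, 16, 4, 26, 8, 20, 6, 16, 8])
    (w₃ := [6, 24, 6, 10])
    (a₁ := [19, 18, -24, -25, 5, 4, -10, -11])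
    (b₁ := [-13, -14, -15, -6, -7, -26, -27, 17, 16, 9, 8, -20, -21, -22, -23, 3, 2, 1])
    (a₂ := [-11, 1, 2, 21, 20, -8, -7, -26, -27, 17, 16, 9, 10, -4, -3, 23, 22, 13])
    (b₂ := [19, 18, -24, -25, 5, 6, 15, 14])
    (a₃ := [13, 14, 15, 16, 17, 18, -24, -23, -22, -21, -20, -19])
    (b₃ := [-11, 1, 2, 3, 4, -10, -9, -8, -7, -6, -5, 25, 26, 27])
    (by decide) (by decide) (by decide) (by decide) (by decide) (by simp) (by simp) (by simp)
    (by decide) (by decide) j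

theorem reach_of_odd {n : ℕ} (hn : 19 ≤ n) (hodd : Odd n) :
    Reach ((3 * n + 3) / 2) (burntStack n) (sortedStack n) := by
  obtain ⟨m, rfl⟩ := hodd
  by_cases h₁ : m = 9
  · subst h₁
    exact reach_nineteen
  by_cases h₂ : m = 11
  · subst h₂
    exact reach_twentyThree
  rcases Nat.even_or_odd' m with ⟨i, rfl | rfl⟩
  · obtain ⟨j, rfl⟩ := Nat.exists_eq_add_of_le (show 5 ≤ i by omega)
    convert reach_twentyOne_add j using 2 <;> omega
  · obtain ⟨j, rfl⟩ := Nat.exists_eq_add_of_le (show 6 ≤ i by omega)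
    convert reach_twentySeven_add j using 2 <;> omega

/-- The sign of the adjacency of `b` directly below `a` in a stack of `n` pancakes which is placed
on top of the two extra entries `n + 1` and `n + 2`. -/
def adjSign (n a b : ℤ) : ℤ :=
  if b = n + 2 then if a = n + 1 then 2 else 0
  else if b = n + 1 then if a = n then 1 else if a = -n then -1 else 0
  else if b = a + 1 then 1 else if b = a - 1 then -1 else 0

/-- The contribution to `weight` of two consecutive entries. -/
def pairWeight (n a b : ℤ) : ℤ :=
  2 * adjSign n a b + (if a = 1 ∧ b = 2 ∨ a = -2 ∧ b = -1 then 1 else 0) -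
    if a = -1 ∧ b = -2 ∨ a = 2 ∧ b = 1 then 1 else 0

/-- The contribution to `weight` of three consecutive entries. -/
def tripleWeight (n a b c : ℤ) : ℤ :=
  if adjSign n a b = adjSign n b c ∨ adjSign n b c = 2 then adjSign n a b else 0

/-- The contribution to `potential` of the two topmost entries. -/
def topWeight (n a b : ℤ) : ℤ :=
  adjSign n a b + (if a = -1 ∧ b ≠ -2 then 1 else 0) - if a = 1 ∧ b ≠ 2 then 1 else 0

/-- The sum of the weights of all pairs and triples of consecutive entries of a list. -/
def weight (n : ℤ) : List ℤ → ℤ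
  | [] => 0
  | [_] => 0
  | [a, b] => pairWeight n a b
  | a :: b :: c :: l => pairWeight n a b + tripleWeight n a b c + weight n (b :: c :: l)

/-- A potential on stacks which increases by at most `4` with each flip. -/
def potential (n : ℤ) : List ℤ → ℤ
  | a :: b :: l => weight n (a :: b :: l) + topWeight n a b
  | _ => 0

theorem weight_append (n w x y z : ℤ) (p r : List ℤ) :
    weight n (p ++ w :: x :: y :: z :: r) = weight n (p ++ [w, x]) + pairWeight n x y +
      tripleWeight n w x y + tripleWeight n x y z + weight n (y :: z :: r) := by
  induction p with
  | nil => simp only [List.nil_append, weight]; ring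
  | cons a p ih =>
    match p, ih with
    | [], ih => simp only [List.nil_append, List.cons_append, weight] at ih ⊢; linarith
    | [b], ih => simp only [List.nil_append, List.cons_append, weight] at ih ⊢; linarith
    | b :: c :: p, ih => simp only [List.cons_append, weight] at ih ⊢; linarith

theorem weight_concat (n w x y : ℤ) (p : List ℤ) :
    weight n (p ++ [w, x, y]) =
      weight n (p ++ [w, x]) + pairWeight n x y + tripleWeight n w x y := by
  induction p with
  | nil => simp only [List.nil_append, weight]; ring
  | cons a p ih =>
    match p, ih with
    | [], ih => simp only [List.nil_append, List.cons_append, weight] at ih ⊢; linarith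
    | [b], ih => simp only [List.nil_append, List.cons_append, weight] at ih ⊢; linarith
    | b :: c :: p, ih => simp only [List.cons_append, weight] at ih ⊢; linarith

theorem adjSign_of_le {n a b : ℤ} (hb : b ≤ n) :
    adjSign n a b = if b = a + 1 then 1 else if b = a - 1 then -1 else 0 := by
  rw [adjSign, if_neg (by omega), if_neg (by omega)]

theorem adjSign_neg_neg {n a b : ℤ} (ha : -n ≤ a) (hb : b ≤ n) :
    adjSign n (-b) (-a) = adjSign n a b := by
  rw [adjSign_of_le hb, adjSign_of_le (by omega)]
  split_ifs <;> omega

theorem adjSign_le_one {n a b : ℤ} (hb : b ≤ n) : adjSign n a b ≤ 1 := by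
  rw [adjSign_of_le hb]
  split_ifs <;> omega

theorem pairWeight_neg_neg {n a b : ℤ} (ha : -n ≤ a) (hb : b ≤ n) :
    pairWeight n (-b) (-a) = pairWeight n a b := by
  unfold pairWeight
  rw [adjSign_neg_neg ha hb]
  congr 1
  · congr 1
    exact if_congr (by omega) rfl rfl
  · exact if_congr (by omega) rfl rfl

theorem tripleWeight_neg_neg {n a b c : ℤ} (ha : -n ≤ a) (hb : -n ≤ b) (hb' : b ≤ n)
    (hc : c ≤ n) : tripleWeight n (-c) (-b) (-a) = tripleWeight n a b c := by
  unfold tripleWeight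
  rw [adjSign_neg_neg ha hb', adjSign_neg_neg hb hc]
  have := adjSign_le_one (a := a) hb'
  have := adjSign_le_one (a := b) hc
  split_ifs <;> omega

theorem weight_negRev {n : ℤ} : ∀ {p : List ℤ}, (∀ x ∈ p, -n ≤ x ∧ x ≤ n) →
    weight n (negRev p) = weight n p
  | [], _ => rfl
  | [_], _ => rfl
  | [a, b], h => by
    simp only [List.mem_cons, forall_eq_or_imp] at h
    simpa [weight] using pairWeight_neg_neg h.1.1 h.2.1.2
  | a :: b :: c :: l, h => by
    have ih := weight_negRev fun x (hx : x ∈ b :: c :: l) => h x (by simp_all)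
    simp only [List.mem_cons, forall_eq_or_imp] at h
    have := weight_concat n (-c) (-b) (-a) (negRev l)
    simp only [negRev_cons, List.append_assoc, List.cons_append, List.nil_append] at ih ⊢
    rw [this, ih, pairWeight_neg_neg h.1.1 h.2.1.2,
      tripleWeight_neg_neg h.1.1 h.2.1.1 h.2.1.2 h.2.2.1.2, weight]
    ring

/-- The part of the change of `potential` caused by a flip that depends on the two topmost entries
`t` and `u` before the flip and on the first two entries `y` and `z` that are not flipped. -/
def gain (n t u y z : ℤ) : ℤ :=
  pairWeight n (-t) y + tripleWeight n (-t) y z + tripleWeight n (-u) (-t) y - topWeight n t u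

/-- The entries `y` and `z` can be consecutive in a stack of `n` pancakes followed by `n + 1` and
`n + 2`. -/
def IsNext (n y z : ℤ) : Prop :=
  y = n + 1 ∧ z = n + 2 ∨
      y ≠ 0 ∧ -n ≤ y ∧ y ≤ n ∧ (z = n + 1 ∨ z ≠ 0 ∧ -n ≤ z ∧ z ≤ n)

theorem topWeight_cases {n t u : ℤ} (hu : u ≠ 0) (hu₂ : u ≤ n) (htu : |t| ≠ |u|) :
    topWeight n t u = adjSign n t u ∧ (t = 1 → u = 2) ∧ (t = -1 → u = -2) ∨
      adjSign n t u = 0 ∧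
      (t = 1 ∧ topWeight n t u = -1 ∨ t = -1 ∧ topWeight n t u = 1) := by
  rw [Ne, abs_eq_abs, not_or] at htu
  rw [topWeight, adjSign_of_le hu₂]
  split_ifs <;> omega

theorem adjSign_cases {n t u : ℤ} (hu₂ : u ≤ n) :
    adjSign n t u = 1 ∧ u = t + 1 ∨ adjSign n t u = -1 ∧ u = t - 1 ∨
      adjSign n t u = 0 ∧ u ≠ t + 1 ∧ u ≠ t - 1 := by
  rw [adjSign_of_le hu₂]
  split_ifs <;> omega

theorem adjSign_cases_plate {n t : ℤ} (hn : 3 ≤ n) :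
    adjSign n t (n + 1) = 1 ∧ t = n ∨ adjSign n t (n + 1) = -1 ∧ t = -n ∨
      adjSign n t (n + 1) = 0 ∧ t ≠ n ∧ t ≠ -n := by
  rw [adjSign, if_neg (by omega), if_pos rfl]
  split_ifs <;> omega

theorem pairWeight_cases (n a b : ℤ) :
    pairWeight n a b = 2 * adjSign n a b + 1 ∧ (a = 1 ∧ b = 2 ∨ a = -2 ∧ b = -1) ∨
    pairWeight n a b = 2 * adjSign n a b - 1 ∧ (a = -1 ∧ b = -2 ∨ a = 2 ∧ b = 1) ∨
    pairWeight n a b = 2 * adjSign n a b ∧ ¬ (a = 1 ∧ b = 2 ∨ a = -2 ∧ b = -1) ∧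
      ¬ (a = -1 ∧ b = -2 ∨ a = 2 ∧ b = 1) := by
  rw [pairWeight]
  split_ifs <;> omega

theorem adjSign_cases_next {n y z : ℤ} (hn : 3 ≤ n) (h : IsNext n y z) :
    adjSign n y z = 2 ∧ y = n + 1 ∧ z = n + 2 ∨ adjSign n y z = 1 ∧ y ≤ n ∧ z = y + 1 ∨
      adjSign n y z = -1 ∧ y ≤ n ∧ (z = y - 1 ∨ z = n + 1 ∧ y = -n) ∨
      adjSign n y z = 0 := by
  rcases h with ⟨rfl, rfl⟩ | ⟨hy, hy₁, hy₂, rfl | ⟨hz, hz₁, hz₂⟩⟩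
  · simp [adjSign]
  · have := adjSign_cases_plate (t := y) hn
    omega
  · have := adjSign_cases (t := y) hz₂
    omega

theorem adjSign_cases_flip {n t y : ℤ} (hn : 3 ≤ n) (h : y ≤ n + 1) :
    adjSign n (-t) y = 1 ∧ (y ≤ n ∧ y = -t + 1 ∨ y = n + 1 ∧ t = -n) ∨
      adjSign n (-t) y = -1 ∧ (y ≤ n ∧ y = -t - 1 ∨ y = n + 1 ∧ t = n) ∨
      adjSign n (-t) y = 0 ∧ (y ≤ n → y ≠ -t + 1 ∧ y ≠ -t - 1) := by
  rcases h.eq_or_lt with rfl | h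
  · have := adjSign_cases_plate (t := -t) hn
    omega
  · have := adjSign_cases (n := n) (t := -t) (u := y) (by omega)
    omega

theorem gain_le {n t u y z : ℤ} (hn : 3 ≤ n) (ht₁ : -n ≤ t)
    (hu : u ≠ 0) (hu₁ : -n ≤ u) (hu₂ : u ≤ n) (htu : |t| ≠ |u|)
    (huy : |u| ≠ |y|) (h : IsNext n y z) :
    gain n t u y z ≤ 1 + if adjSign n (-t) y = 1 then
      if 1 ≤ adjSign n y z ∨ y = -1 then 2 else 1 else 0 := by
  have hyz : y ≠ 0 ∧ z ≠ 0 ∧ y ≤ n + 1 := by unfold IsNext at h; omega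
  have h₁ := topWeight_cases hu hu₂ htu
  have h₂ := adjSign_cases (n := n) (t := t) hu₂
  have h₃ := adjSign_cases_flip (n := n) (t := t) (y := y) hn hyz.2.2
  have h₄ := adjSign_cases_next hn h
  clear h
  have h₅ := pairWeight_cases n (-t) y
  rw [Ne, abs_eq_abs, not_or] at huy
  have h₆ : adjSign n (-t) y = 1 → adjSign n t u ≠ -1 := by
    clear h₁ h₄ h₅ hu htu
    omega
  rw [gain, tripleWeight, tripleWeight, adjSign_neg_neg ht₁ hu₂]
  clear htu huy hu
  generalize adjSign n (-t) y = a at *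
  generalize adjSign n y z = b at *
  generalize adjSign n t u = c at *
  generalize topWeight n t u = W at *
  generalize pairWeight n (-t) y = P at *
  rcases h₃ with ⟨rfl, h₃⟩ | ⟨rfl, h₃⟩ | ⟨rfl, h₃⟩
  · rcases h₂ with ⟨rfl, h₂⟩ | ⟨rfl, h₂⟩ | ⟨rfl, h₂⟩ <;> norm_num <;> split_ifs <;> omega
  · clear h₃ h₄
    rcases h₂ with ⟨rfl, h₂⟩ | ⟨rfl, h₂⟩ | ⟨rfl, h₂⟩ <;> norm_num <;> split_ifs <;> omega
  · have hP : P = 0 := by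
      clear h₁ h₂ h₄ h₆
      omega
    clear h₃ h₄ h₅
    rcases h₂ with ⟨rfl, h₂⟩ | ⟨rfl, h₂⟩ | ⟨rfl, h₂⟩ <;> norm_num <;> omega

theorem le_gain {n t u y z : ℤ} (hn : 3 ≤ n) (ht₁ : -n ≤ t)
    (hu : u ≠ 0) (hu₂ : u ≤ n) (htu : |t| ≠ |u|)
    (huy : |u| ≠ |y|) (h : IsNext n y z) :
    (-1 - if adjSign n (-t) y = -1 then
      if adjSign n y z = -1 ∨ adjSign n y z = 2 ∨ y = 1 then 2 else 1 else 0) ≤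
      gain n t u y z := by
  have hyz : y ≠ 0 ∧ z ≠ 0 ∧ y ≤ n + 1 := by unfold IsNext at h; omega
  have h₁ := topWeight_cases hu hu₂ htu
  have h₂ := adjSign_cases (n := n) (t := t) hu₂
  have h₃ := adjSign_cases_flip (n := n) (t := t) (y := y) hn hyz.2.2
  have h₄ := adjSign_cases_next hn h
  clear h
  have h₅ := pairWeight_cases n (-t) y
  rw [Ne, abs_eq_abs, not_or] at huy
  have h₆ : adjSign n (-t) y = -1 → adjSign n t u ≠ 1 := by
    clear h₁ h₄ h₅ hu htu
    omega
  rw [gain, tripleWeight, tripleWeight, adjSign_neg_neg ht₁ hu₂]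
  clear htu huy hu
  generalize adjSign n (-t) y = a at *
  generalize adjSign n y z = b at *
  generalize adjSign n t u = c at *
  generalize topWeight n t u = W at *
  generalize pairWeight n (-t) y = P at *
  rcases h₃ with ⟨rfl, h₃⟩ | ⟨rfl, h₃⟩ | ⟨rfl, h₃⟩
  · clear h₃ h₄
    rcases h₂ with ⟨rfl, h₂⟩ | ⟨rfl, h₂⟩ | ⟨rfl, h₂⟩ <;> norm_num <;> split_ifs <;> omega
  · rcases h₂ with ⟨rfl, h₂⟩ | ⟨rfl, h₂⟩ | ⟨rfl, h₂⟩ <;> norm_num <;> split_ifs <;> omega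
  · have hP : P = 0 := by
      clear h₁ h₂ h₄ h₆
      omega
    clear h₃ h₄ h₅
    rcases h₂ with ⟨rfl, h₂⟩ | ⟨rfl, h₂⟩ | ⟨rfl, h₂⟩ <;> norm_num <;> omega


theorem gain_sub_gain_le {n t u t' u' y z : ℤ} (hn : 3 ≤ n) (ht : t ≠ 0) (ht₁ : -n ≤ t)
    (ht₂ : t ≤ n) (hu : u ≠ 0) (hu₁ : -n ≤ u) (hu₂ : u ≤ n) (htu : |t| ≠ |u|) (htz : |t| ≠ |z|)
    (huy : |u| ≠ |y|) (ht' : t' ≠ 0) (ht₁' : -n ≤ t') (hu' : u' ≠ 0)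
    (hu₂' : u' ≤ n) (htu' : |t'| ≠ |u'|) (htz' : |t'| ≠ |z|) (huy' : |u'| ≠ |y|)
    (htt' : |t| ≠ |t'|) (h : IsNext n y z) :
    gain n t u y z - gain n t' u' y z ≤ 4 := by
  have h₁ := gain_le hn ht₁ hu hu₁ hu₂ htu huy h
  have h₂ := le_gain hn ht₁' hu' hu₂' htu' huy' h
  have h₃ := adjSign_cases_flip (n := n) (t := t) (y := y) hn (by unfold IsNext at h; omega)
  have h₄ := adjSign_cases_flip (n := n) (t := t') (y := y) hn (by unfold IsNext at h; omega)
  have h₅ := adjSign_cases_next hn h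
  rw [Ne, abs_eq_abs, not_or] at htz htz' htt'
  by_cases e : adjSign n (-t) y = 1 ∧ adjSign n (-t') y = -1
  · have h₆ : y ≤ n ∧ y = -t + 1 := by omega
    have h₇ : y = -t' - 1 := by omega
    rw [if_pos e.1, if_neg (by omega)] at h₁
    rw [if_pos e.2, if_neg (by omega)] at h₂
    omega
  · clear h₃ h₄ h₅ htz htz' htt'
    split_ifs at h₁ h₂ <;> omega

theorem pairWeight_add_le {n t y z : ℤ} (hn : 3 ≤ n) (hty : |t| ≠ |y|) (hy : y ≤ n)
    (h : IsNext n y z) :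
    pairWeight n t y + tripleWeight n t y z + topWeight n t y ≤
      if adjSign n t y = 1 then if t = 1 ∧ y = 2 then 5 else 4
      else if t = -1 then 1 else if t = 1 then -1 else 0 := by
  have hy₀ : y ≠ 0 := by unfold IsNext at h; omega
  have h₁ := topWeight_cases hy₀ hy hty
  have h₂ := pairWeight_cases n t y
  have h₃ := adjSign_cases (n := n) (t := t) hy
  have h₄ := adjSign_cases_next hn h
  rw [Ne, abs_eq_abs, not_or] at hty
  unfold IsNext at h
  rw [tripleWeight]
  generalize adjSign n t y = a at *
  generalize adjSign n y z = b at *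
  generalize topWeight n t y = W at *
  generalize pairWeight n t y = P at *
  rcases h₃ with ⟨rfl, h₃⟩ | ⟨rfl, h₃⟩ | ⟨rfl, h₃⟩ <;> norm_num <;> split_ifs <;> omega

theorem le_pairWeight_add {n t y z : ℤ} (hn : 3 ≤ n) (hty : |t| ≠ |y|) (hy : y ≤ n)
    (h : IsNext n y z) :
    (if adjSign n t y = -1 then if t = -1 ∧ y = -2 then -5 else -4
      else if t = -1 then 1 else if t = 1 then -1 else 0) ≤
      pairWeight n t y + tripleWeight n t y z + topWeight n t y := by
  have hy₀ : y ≠ 0 := by unfold IsNext at h; omega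
  have h₁ := topWeight_cases hy₀ hy hty
  have h₂ := pairWeight_cases n t y
  have h₃ := adjSign_cases (n := n) (t := t) hy
  have h₄ := adjSign_cases_next hn h
  rw [Ne, abs_eq_abs, not_or] at hty
  unfold IsNext at h
  rw [tripleWeight]
  generalize adjSign n t y = a at *
  generalize adjSign n y z = b at *
  generalize topWeight n t y = W at *
  generalize pairWeight n t y = P at *
  rcases h₃ with ⟨rfl, h₃⟩ | ⟨rfl, h₃⟩ | ⟨rfl, h₃⟩ <;> norm_num <;> split_ifs <;> omega

theorem pairWeight_sub_pairWeight_le {n t y z : ℤ} (hn : 3 ≤ n)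
    (hty : |t| ≠ |y|) (hy : y ≤ n) (h : IsNext n y z) :
    pairWeight n (-t) y + tripleWeight n (-t) y z + topWeight n (-t) y -
      (pairWeight n t y + tripleWeight n t y z + topWeight n t y) ≤ 4 := by
  have hy₀ : y ≠ 0 := by unfold IsNext at h; omega
  have h₁ := pairWeight_add_le hn (t := -t) (by rwa [abs_neg]) hy h
  have h₂ := le_pairWeight_add hn hty hy h
  have h₃ := adjSign_cases (n := n) (t := t) hy
  have h₄ := adjSign_cases (n := n) (t := -t) hy
  split_ifs at h₁ h₂ <;> omega

theorem exists_eq_cons_cons {p : List ℤ} (hp : 2 ≤ p.length) : ∃ a b q, p = a :: b :: q := by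
  match p, hp with
  | a :: b :: q, _ => exact ⟨a, b, q, rfl⟩

theorem exists_eq_append_pair {p : List ℤ} (hp : 2 ≤ p.length) :
    ∃ q a b, p = q ++ [a, b] := by
  obtain ⟨a, b, q, h⟩ := exists_eq_cons_cons (p := p.reverse) (by simpa)
  exact ⟨q.reverse, b, a, by simpa using congrArg List.reverse h⟩

theorem potential_flip_le {n : ℤ} (hn : 3 ≤ n) {p r : List ℤ} {y z : ℤ} (hp : p ≠ [])
    (hpn : ∀ x ∈ p, x ≠ 0 ∧ -n ≤ x ∧ x ≤ n) (hyz : IsNext n y z)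
    (h : ((p ++ y :: z :: r).map abs).Nodup) (h' : p.length = 1 → y ≤ n) :
    potential n (negRev p ++ y :: z :: r) ≤ potential n (p ++ y :: z :: r) + 4 := by
  rcases Nat.lt_or_ge 1 p.length with hl | hl
  · obtain ⟨t, u, m, h₁⟩ := exists_eq_cons_cons hl
    obtain ⟨m', w, x, h₂⟩ := exists_eq_append_pair hl
    have e₁ : potential n (p ++ y :: z :: r) =
        weight n (p ++ y :: z :: r) + topWeight n t u := by simp [h₁, potential]
    have e₂ : potential n (negRev p ++ y :: z :: r) =
        weight n (negRev p ++ y :: z :: r) + topWeight n (-x) (-w) := by simp [h₂, potential]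
    have e₃ : weight n (p ++ y :: z :: r) = weight n p + pairWeight n x y +
        tripleWeight n w x y + tripleWeight n x y z + weight n (y :: z :: r) := by
      simpa [h₂] using weight_append n w x y z m' r
    have e₄ : weight n (negRev p ++ y :: z :: r) = weight n (negRev p) + pairWeight n (-t) y +
        tripleWeight n (-u) (-t) y + tripleWeight n (-t) y z + weight n (y :: z :: r) := by
      simpa [h₁] using weight_append n (-u) (-t) y z (negRev m) r
    have e₅ := weight_negRev fun x hx => (hpn x hx).2
    have ht := hpn t (by simp [h₁])
    have hu := hpn u (by simp [h₁])
    have hw := hpn w (by simp [h₂])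
    have hx := hpn x (by simp [h₂])
    rw [List.map_append, List.nodup_append] at h
    obtain ⟨hd, -, hd'⟩ := h
    have hne : ∀ a ∈ p, |a| ≠ |y| ∧ |a| ≠ |z| := fun a ha =>
      ⟨hd' _ (List.mem_map_of_mem ha) _ (by simp), hd' _ (List.mem_map_of_mem ha) _ (by simp)⟩
    have htu : |t| ≠ |u| := by
      simp only [h₁, List.map_cons, List.nodup_cons, List.mem_cons, not_or] at hd
      exact hd.1.1
    have hwx : |w| ≠ |x| := by
      simp only [h₂, List.map_append, List.nodup_append, List.map_cons, List.nodup_cons,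
        List.mem_cons, not_or] at hd
      exact hd.2.1.1.1
    have htx : |t| ≠ |x| := by
      rw [h₁, List.map_cons, List.nodup_cons] at hd
      intro e
      refine hd.1 (e ▸ List.mem_map_of_mem ?_)
      cases m' with
      | nil =>
        have := h₁.symm.trans h₂
        simp_all
      | cons a m' =>
        have := h₁.symm.trans h₂
        simp only [List.cons_append, List.cons.injEq] at this
        simp [this.2]
    have key := gain_sub_gain_le hn ht.1 ht.2.1 ht.2.2 hu.1 hu.2.1 hu.2.2 htu
      (hne t (by simp [h₁])).2
      (hne u (by simp [h₁])).1 (neg_ne_zero.2 hx.1) (by omega) (neg_ne_zero.2 hw.1)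
      (by omega) (by rw [abs_neg, abs_neg]; exact hwx.symm)
      (by rw [abs_neg]; exact (hne x (by simp [h₂])).2)
      (by rw [abs_neg]; exact (hne w (by simp [h₂])).1) (by rwa [abs_neg]) hyz
    simp only [gain, neg_neg] at key
    linarith
  · obtain ⟨t, rfl⟩ := List.length_eq_one_iff.1 (hl.antisymm (List.length_pos_iff.2 hp))
    have ht := hpn t (by simp)
    simp only [List.cons_append, List.nil_append, List.map_cons, List.nodup_cons, List.mem_cons,
      not_or] at h
    have := pairWeight_sub_pairWeight_le hn h.1.1 (h' rfl) hyz
    simp only [negRev_cons, negRev_nil, List.cons_append, List.nil_append, potential, weight]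
    linarith

/-- The entries of the stack `l` have distinct absolute values in `{1, ..., n}`. -/
def IsStack (n : ℤ) (l : List ℤ) : Prop :=
  (∀ x ∈ l, x ≠ 0 ∧ -n ≤ x ∧ x ≤ n) ∧ (l.map abs).Nodup

theorem IsStack.pancakeFlip {n : ℤ} {l : List ℤ} (h : IsStack n l) (k : ℕ) :
    IsStack n (pancakeFlip k l) := by
  obtain ⟨h₁, h₂⟩ := h
  constructor
  · intro x hx
    simp only [_root_.pancakeFlip, List.mem_append, List.mem_reverse, List.mem_map] at hx
    obtain ⟨y, hy, rfl⟩ | hx := hx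
    · have := h₁ y (List.mem_of_mem_take hy)
      omega
    · exact h₁ x (List.mem_of_mem_drop hx)
  · have e : (_root_.pancakeFlip k l).map abs =
        ((l.take k).map abs).reverse ++ (l.drop k).map abs := by
      simp [_root_.pancakeFlip, Function.comp_def]
    rw [e, ((List.reverse_perm _).append_right _).nodup_iff, ← List.map_append,
      List.take_append_drop]
    exact h₂

theorem potential_pancakeFlip_le {n : ℤ} (hn : 3 ≤ n) {l : List ℤ} (h : IsStack n l)
    (hl : 2 ≤ l.length) {k : ℕ} (hk : 1 ≤ k) :
    potential n (pancakeFlip k l ++ [n + 1, n + 2]) ≤ potential n (l ++ [n + 1, n + 2]) + 4 := by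
  obtain ⟨h₁, h₂⟩ := h
  have hp : l.take k ≠ [] := by
    rw [← List.length_pos_iff, List.length_take]
    omega
  have hpn : ∀ x ∈ l.take k, x ≠ 0 ∧ -n ≤ x ∧ x ≤ n :=
    fun x hx => h₁ x (List.mem_of_mem_take hx)
  have hqn : ∀ x ∈ l.drop k, x ≠ 0 ∧ -n ≤ x ∧ x ≤ n :=
    fun x hx => h₁ x (List.mem_of_mem_drop hx)
  have hnd : ((l ++ [n + 1, n + 2]).map abs).Nodup := by
    rw [List.map_append, List.nodup_append]
    refine ⟨h₂, ?_, ?_⟩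
    · simp only [List.map_cons, List.map_nil, List.nodup_cons, List.mem_singleton]
      rw [abs_eq_abs]
      simp
      omega
    · intro a ha b hb
      obtain ⟨x, hx, rfl⟩ := List.mem_map.1 ha
      have hx' := abs_le.2 (h₁ x hx).2
      have e₁ : |n + 1| = n + 1 := abs_of_pos (by omega)
      have e₂ : |n + 2| = n + 2 := abs_of_pos (by omega)
      simp only [List.map_cons, List.map_nil, List.mem_cons, List.not_mem_nil, or_false] at hb
      omega
  obtain ⟨y, z, r, hr, hyz, hy⟩ : ∃ y z r, l.drop k ++ [n + 1, n + 2] = y :: z :: r ∧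
      IsNext n y z ∧ (l.drop k ≠ [] → y ≤ n) := by
    unfold IsNext
    match l.drop k, hqn with
    | [], _ => exact ⟨n + 1, n + 2, [], by simp⟩
    | [y], hqn =>
      refine ⟨y, n + 1, [n + 2], rfl, ?_⟩
      have := hqn y (by simp)
      simp [this]
    | y :: z :: r, hqn =>
      refine ⟨y, z, r ++ [n + 1, n + 2], rfl, ?_⟩
      have := hqn y (by simp)
      have := hqn z (by simp)
      simp [*]
  have e : l ++ [n + 1, n + 2] = l.take k ++ y :: z :: r := by
    rw [← hr, ← List.append_assoc, List.take_append_drop]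
  have e' : pancakeFlip k l ++ [n + 1, n + 2] = negRev (l.take k) ++ y :: z :: r := by
    rw [← hr, pancakeFlip, negRev, List.append_assoc]
  rw [e] at hnd ⊢
  rw [e']
  refine potential_flip_le hn hp hpn hyz hnd fun h => hy ?_
  rw [← List.length_pos_iff, List.length_drop]
  rw [List.length_take] at h
  omega

theorem potential_applyFlips_le {n : ℤ} (hn : 3 ≤ n) {ks : List ℕ} (hks : ∀ k ∈ ks, 1 ≤ k) :
    ∀ {l : List ℤ}, IsStack n l → 2 ≤ l.length →
      potential n (applyFlips ks l ++ [n + 1, n + 2]) ≤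
        potential n (l ++ [n + 1, n + 2]) + 4 * ks.length := by
  induction ks with
  | nil => simp
  | cons k ks ih =>
    intro l h hl
    have h₁ := potential_pancakeFlip_le hn h hl (hks k (by simp))
    have h₂ := ih (fun k hk => hks k (by simp [hk])) (h.pancakeFlip k) (by simpa using hl)
    rw [applyFlips_cons, List.length_cons]
    push_cast
    linarith

theorem isStack_burntStack (n : ℕ) : IsStack n (burntStack n) := by
  rw [burntStack_eq_map]
  constructor
  · intro x hx
    obtain ⟨i, hi, rfl⟩ := List.mem_map.1 hx
    have := List.mem_range.1 hi
    omega
  · rw [List.map_map]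
    refine List.Nodup.map ?_ List.nodup_range
    intro i j h
    simp only [Function.comp_apply, abs_neg] at h
    rw [abs_of_pos (by omega), abs_of_pos (by omega)] at h
    omega

theorem weight_cons_cons_cons {n a b c : ℤ} {l : List ℤ} : weight n (a :: b :: c :: l) =
    pairWeight n a b + tripleWeight n a b c + weight n (b :: c :: l) := rfl

/-- The stack `[s * (j + 1), ..., s * (j + m)]`. -/
def monotoneRun (s : ℤ) (j m : ℕ) : List ℤ :=
  (List.range m).map fun i : ℕ => s * ((j + i : ℕ) + 1)

theorem monotoneRun_succ (s : ℤ) (j m : ℕ) :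
    monotoneRun s j (m + 1) = s * (j + 1) :: monotoneRun s (j + 1) m := by
  rw [monotoneRun, monotoneRun, List.range_succ_eq_map, List.map_cons, List.map_map]
  congr 2
  ext i
  simp only [Function.comp_apply, Nat.succ_eq_add_one]
  push_cast
  ring

theorem exists_monotoneRun_append {n : ℕ} {s : ℤ} {j m : ℕ} (h : j + (m + 1) = n) :
    ∃ c r, monotoneRun s j (m + 1) ++ [(n : ℤ) + 1, (n : ℤ) + 2] = s * (j + 1) :: c :: r ∧
      monotoneRun s (j + 1) m ++ [(n : ℤ) + 1, (n : ℤ) + 2] = c :: r ∧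
      (m = 0 ∧ c = n + 1 ∨ 0 < m ∧ c = s * (j + 2)) := by
  obtain - | m := m
  · exact ⟨_, _, rfl, rfl, Or.inl ⟨rfl, rfl⟩⟩
  · refine ⟨s * (j + 2), monotoneRun s (j + 2) m ++ [(n : ℤ) + 1, (n : ℤ) + 2], ?_, ?_, ?_⟩
    · rw [monotoneRun_succ, monotoneRun_succ]
      push_cast
      simp only [List.cons_append]
      ring_nf
    · rw [monotoneRun_succ]
      push_cast
      simp only [List.cons_append]
      ring_nf
    · omega

theorem adjSign_mul {n s i : ℤ} (hs : s = 1 ∨ s = -1) (hi : 1 ≤ i) {c : ℤ}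
    (h : i = n ∧ c = n + 1 ∨ i < n ∧ c = s * (i + 1)) : adjSign n (s * i) c = s := by
  rw [adjSign]
  rcases hs with rfl | rfl <;> split_ifs <;> omega

theorem weight_monotoneRun {n : ℕ} (hn : 3 ≤ n) {s : ℤ} (hs : s = 1 ∨ s = -1) {m : ℕ} :
    ∀ {j : ℕ}, 1 ≤ j → j + (m + 1) = n →
      weight n (monotoneRun s j (m + 1) ++ [(n : ℤ) + 1, (n : ℤ) + 2]) =
        4 + s * (3 * (m + 1)) := by
  induction m with
  | zero =>
    intro j hj h
    obtain rfl : n = j + 1 := by omega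
    simp [monotoneRun, weight, pairWeight, tripleWeight, adjSign]
    rcases hs with rfl | rfl <;> norm_num <;> split_ifs <;> omega
  | succ m ih =>
    intro j hj h
    obtain ⟨c, r, h₁, h₂, hc⟩ := exists_monotoneRun_append (s := s) (j := j + 1) (m := m)
      (n := n) (by omega)
    have := ih (j := j + 1) (by omega) (by omega)
    rw [h₁] at this
    rw [monotoneRun_succ, List.cons_append, h₁, weight_cons_cons_cons, this]
    clear this h₁ h₂ ih
    push_cast at hc ⊢
    have e₁ : adjSign n (s * (j + 1)) (s * (j + 1 + 1)) = s :=
      adjSign_mul hs (by omega) (Or.inr ⟨by omega, rfl⟩)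
    have e₂ : adjSign n (s * (j + 1 + 1)) c = s := by
      refine adjSign_mul hs (by omega) ?_
      rw [show (j : ℤ) + 1 + 1 + 1 = j + 1 + 2 by ring]
      omega
    rw [pairWeight, tripleWeight, e₁, e₂, if_pos (Or.inl rfl), if_neg, if_neg]
    · ring
    all_goals rcases hs with rfl | rfl <;> omega

theorem potential_monotoneRun {n : ℕ} (hn : 3 ≤ n) {s : ℤ} (hs : s = 1 ∨ s = -1) :
    potential n (monotoneRun s 0 n ++ [(n : ℤ) + 1, (n : ℤ) + 2]) = 4 + s * (3 * n + 2) := by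
  obtain ⟨m, rfl⟩ : ∃ m, n = m + 2 := ⟨n - 2, by omega⟩
  obtain ⟨c, r, h₁, h₂, hc⟩ := exists_monotoneRun_append (s := s) (j := 1) (m := m)
    (n := m + 2) (by omega)
  have := weight_monotoneRun hn hs (j := 1) (m := m) le_rfl (by omega)
  rw [h₁] at this
  rw [monotoneRun_succ, List.cons_append, h₁, potential, weight_cons_cons_cons, this]
  clear this h₁ h₂
  push_cast at hc ⊢
  have e₁ : adjSign (m + 2) (s * 1) (s * 2) = s :=
    adjSign_mul hs (by omega) (Or.inr ⟨by omega, by norm_num⟩)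
  have e₂ : adjSign (m + 2) (s * 2) c = s := by
    refine adjSign_mul hs (by omega) ?_
    norm_num
    omega
  rw [pairWeight, tripleWeight, topWeight, e₁, e₂, if_pos (Or.inl rfl)]
  rcases hs with rfl | rfl <;> norm_num <;> ring

theorem sortedStack_eq_monotoneRun (n : ℕ) : sortedStack n = monotoneRun 1 0 n := by
  simp [sortedStack_eq_map, monotoneRun]

theorem burntStack_eq_monotoneRun (n : ℕ) : burntStack n = monotoneRun (-1) 0 n := by
  simp [burntStack_eq_map, monotoneRun]

theorem three_mul_add_two_le_of_isSortingSeq {n : ℕ} (hn : 3 ≤ n) {ks : List ℕ}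
    (h : IsSortingSeq n ks) : 3 * n + 2 ≤ 2 * ks.length := by
  have := potential_applyFlips_le (by exact_mod_cast hn) (fun k hk => (h.1 k hk).1)
    (isStack_burntStack n) (by simp [burntStack_eq_map]; omega)
  rw [h.2, sortedStack_eq_monotoneRun, burntStack_eq_monotoneRun,
    potential_monotoneRun hn (Or.inl rfl), potential_monotoneRun hn (Or.inr rfl)] at this
  omega

/-- For every odd integer `n ≥ 19`, `T n = (3n+3)/2`. -/
theorem T_eq_of_odd (n : ℕ) (hn : 19 ≤ n) (hodd : Odd n) :
    T n = (3 * n + 3) / 2 := by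
  obtain ⟨ks, hl, hks, h⟩ := reach_of_odd hn hodd
  have hmem : (3 * n + 3) / 2 ∈ {m | ∃ ks : List ℕ, IsSortingSeq n ks ∧ ks.length = m} :=
    ⟨ks, ⟨by simpa [burntStack_eq_map] using hks, h⟩, hl⟩
  refine le_antisymm (Nat.sInf_le hmem) (le_csInf ⟨_, hmem⟩ ?_)
  rintro _ ⟨ks, hs, rfl⟩
  have := three_mul_add_two_le_of_isSortingSeq (by omega) hs
  obtain ⟨k, rfl⟩ := hodd
  omega
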